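/- Fix c ≥ 1 and let ŝ = (α_1, α_2, …) be the infinite stepsize schedule obtained by recursively concatenating silver schedules with k_j = ⌊2·2^{cj}⌋ copies of the j-th silver schedule, and let t_i denote the length of the i-th partially concatenated schedule ŝ_i. Let f: ℝ^d → ℝ be convex, differentiable with 1-Lipschitz gradient, with minimizer x*, and run gradient descent x_{t+1} = x_t − α_t ∇f(x_t) from any x_1, writing f_t = f(x_t) and g_t = ∇f(x_t). Then for every i ≥ 1 and every ℓ with t_i + 1 < ℓ ≤ t_{i+1}, one has f_ℓ − f_{t_i+1} ≤ 432·α_{t_i+1}²·‖g_{t_i+1}‖². -/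

import Mathlib

open Finset
open scoped RealInnerProductSpace

noncomputable section

/-- Gradient-descent trajectory along a finite list of stepsizes. -/
def gdIter {E : Type*} [AddCommGroup E] [SMul ℝ E] (g : E → E) : E → List ℝ → E
  | x, [] => x
  | x, a :: L => gdIter g (x - a • g x) L

/-- A finite stepsize schedule (of positive reals) is primitive if the key
gradient-descent inequality holds for every smooth convex problem instance. -/
def IsPrimitive (L : List ℝ) : Prop :=
  (∀ a ∈ L, (0:ℝ) < a) ∧
  ∀ (d : ℕ) (f : EuclideanSpace ℝ (Fin d) → ℝ)
    (g : EuclideanSpace ℝ (Fin d) → EuclideanSpace ℝ (Fin d)),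
    ConvexOn ℝ Set.univ f →
    (∀ y, HasGradientAt f (g y) y) →
    LipschitzWith 1 g →
    ∀ xstar : EuclideanSpace ℝ (Fin d), IsMinOn f Set.univ xstar →
    ∀ x1 : EuclideanSpace ℝ (Fin d),
      L.sum * (f (gdIter g x1 L) - f xstar)
        + (L.sum * (L.sum + 1) / 2) * ‖g (gdIter g x1 L)‖ ^ 2
        + 2⁻¹ * ‖gdIter g x1 L - xstar‖ ^ 2
      ≤ 2⁻¹ * ‖x1 - xstar‖ ^ 2
        + ∑ i : Fin L.length,
            L.get i *
              (f (gdIter g x1 (L.take i.1)) - f xstar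
                - ⟪g (gdIter g x1 (L.take i.1)), gdIter g x1 (L.take i.1) - xstar⟫
                + 2⁻¹ * ‖g (gdIter g x1 (L.take i.1))‖ ^ 2)

/-- The join-stepsize function. -/
def phi (x y : ℝ) : ℝ :=
  (-(x + y) + Real.sqrt ((x + y + 2) ^ 2 + 4 * (x + 1) * (y + 1))) / 2

/-- Concatenation of two stepsize schedules with the join stepsize in between. -/
def concatSched (s r : List ℝ) : List ℝ := s ++ phi s.sum r.sum :: r

/-- The silver stepsize schedules. -/
def silver : ℕ → List ℝ
  | 0 => []
  | i + 1 => concatSched (silver i) (silver i)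

/-- Recursive concatenation of a sequence of schedules. -/
def concatAll (s : ℕ → List ℝ) : ℕ → List ℝ
  | 0 => []
  | i + 1 => concatSched (concatAll s i) (s (i + 1))

/-- The number of copies of the `j`-th silver schedule. -/
def kSeq (c : ℝ) (j : ℕ) : ℕ := ⌊2 * (2:ℝ) ^ (c * j)⌋₊

def MSeq (c : ℝ) (j : ℕ) : ℕ := ∑ j' ∈ Finset.Icc 1 j, kSeq c j'

/-- The block index `j` of `i`, i.e. the `j` with `M_{j-1} < i ≤ M_j`. -/
def blockIdx (c : ℝ) (i : ℕ) : ℕ := sInf {j | i ≤ MSeq c j}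

/-- The partially concatenated schedules `ŝ_i`. -/
def shatSched (c : ℝ) : ℕ → List ℝ := concatAll fun i => silver (blockIdx c i)

/-- The `t`-th entry (1-indexed) of the infinite limiting schedule `ŝ`. -/
def shatEntry (c : ℝ) (t : ℕ) : ℝ := (shatSched c t).getD (t - 1) 0

section Cocoercivity

variable {E : Type*} [NormedAddCommGroup E] [InnerProductSpace ℝ E]

/-- The interpolation inequality satisfied by convex functions `f` with `1`-Lipschitz gradient
`g`. -/
def Cocoercive (f : E → ℝ) (g : E → E) : Prop :=
  ∀ x y, f x + ⟪g x, y - x⟫ + 2⁻¹ * ‖g y - g x‖ ^ 2 ≤ f y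

variable [CompleteSpace E]

lemma hasDerivAt_comp_add_smul {f : E → ℝ} {g : E → E} (hgrad : ∀ y, HasGradientAt f (g y) y)
    (x v : E) (t : ℝ) :
    HasDerivAt (fun t : ℝ => f (x + t • v)) ⟪g (x + t • v), v⟫ t := by
  have h1 : HasDerivAt (fun t : ℝ => x + t • v) v t := by
    simpa using ((hasDerivAt_id t).smul_const v).const_add x
  have h2 := (hgrad (x + t • v)).hasFDerivAt.comp_hasDerivAt t h1
  rwa [InnerProductSpace.toDual_apply_apply] at h2

lemma add_inner_sub_le_of_convexOn {f : E → ℝ} {g : E → E} (hconv : ConvexOn ℝ Set.univ f)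
    (hgrad : ∀ y, HasGradientAt f (g y) y) (x y : E) :
    f x + ⟪g x, y - x⟫ ≤ f y := by
  have hc : ConvexOn ℝ Set.univ (fun t : ℝ => f (x + t • (y - x))) := by
    have := hconv.comp_affineMap (AffineMap.lineMap x y : ℝ →ᵃ[ℝ] E)
    refine this.congr fun t _ => ?_
    simp [AffineMap.lineMap_apply, add_comm]
  have hd := hasDerivAt_comp_add_smul hgrad x (y - x) 0
  have := hc.le_slope_of_hasDerivAt (Set.mem_univ 0) (Set.mem_univ 1) one_pos hd
  simp [slope_def_field] at this
  linarith

lemma le_add_inner_sub_add_norm_sq {f : E → ℝ} {g : E → E}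
    (hgrad : ∀ y, HasGradientAt f (g y) y) (hlip : LipschitzWith 1 g) (x y : E) :
    f y ≤ f x + ⟪g x, y - x⟫ + 2⁻¹ * ‖y - x‖ ^ 2 := by
  set v := y - x with hv
  have hd : ∀ t : ℝ, HasDerivAt
      (fun t : ℝ => f (x + t • v) - t * ⟪g x, v⟫ - t ^ 2 * (2⁻¹ * ‖v‖ ^ 2))
      (⟪g (x + t • v), v⟫ - ⟪g x, v⟫ - t * ‖v‖ ^ 2) t := fun t => by
    have h := ((hasDerivAt_comp_add_smul hgrad x v t).sub
      ((hasDerivAt_id t).mul_const ⟪g x, v⟫)).sub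
      ((hasDerivAt_pow 2 t).mul_const (2⁻¹ * ‖v‖ ^ 2))
    refine h.congr_deriv ?_
    push_cast
    ring
  have hanti := antitoneOn_of_deriv_nonpos (convex_Ici (0 : ℝ))
    (fun t _ => (hd t).continuousAt.continuousWithinAt)
    (fun t _ => (hd t).differentiableAt.differentiableWithinAt) (fun t ht => by
      rw [interior_Ici, Set.mem_Ioi] at ht
      rw [(hd t).deriv, ← inner_sub_left]
      have h1 : ‖g (x + t • v) - g x‖ ≤ t * ‖v‖ := by
        simpa [norm_smul, abs_of_pos ht] using hlip.norm_sub_le (x + t • v) x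
      have h2 := real_inner_le_norm (g (x + t • v) - g x) v
      nlinarith [mul_le_mul_of_nonneg_right h1 (norm_nonneg v)])
  have := hanti (Set.mem_Ici.2 le_rfl) (Set.mem_Ici.2 zero_le_one) zero_le_one
  simp [hv] at this
  linarith

lemma cocoercive_of_convexOn {f : E → ℝ} {g : E → E} (hconv : ConvexOn ℝ Set.univ f)
    (hgrad : ∀ y, HasGradientAt f (g y) y) (hlip : LipschitzWith 1 g) : Cocoercive f g := by
  intro x y
  have h1 := add_inner_sub_le_of_convexOn hconv hgrad x (y - (g y - g x))
  have h2 := le_add_inner_sub_add_norm_sq hgrad hlip y (y - (g y - g x))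
  have e1 : y - (g y - g x) - y = -(g y - g x) := by abel
  have e2 : y - (g y - g x) - x = (y - x) - (g y - g x) := by abel
  rw [e1, norm_neg, inner_neg_right] at h2
  rw [e2, inner_sub_right] at h1
  have h3 : ⟪g y, g y - g x⟫ - ⟪g x, g y - g x⟫ = ‖g y - g x‖ ^ 2 := by
    rw [← inner_sub_left, real_inner_self_eq_norm_sq]
  linarith

end Cocoercivity

section Potential

variable {E : Type*} [NormedAddCommGroup E] [InnerProductSpace ℝ E]

lemma gdIter_append (g : E → E) (x : E) (s r : List ℝ) :
    gdIter g x (s ++ r) = gdIter g (gdIter g x s) r := by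
  induction s generalizing x with
  | nil => rfl
  | cons a s ih => exact ih _

/-- The stepsize-weighted sum, along a gradient-descent run, of the terms
`f (x_i) - ⟪g (x_i), x_i - z⟫ + ‖g (x_i)‖ ^ 2 / 2`. -/
def weightedDual (f : E → ℝ) (g : E → E) (z : E) : E → List ℝ → ℝ
  | _, [] => 0
  | x, a :: L =>
    a * (f x - ⟪g x, x - z⟫ + 2⁻¹ * ‖g x‖ ^ 2) + weightedDual f g z (x - a • g x) L

lemma weightedDual_append (f : E → ℝ) (g : E → E) (z x : E) (s r : List ℝ) :
    weightedDual f g z x (s ++ r) =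
      weightedDual f g z x s + weightedDual f g z (gdIter g x s) r := by
  induction s generalizing x with
  | nil => simp [weightedDual, gdIter]
  | cons a s ih => simp [weightedDual, gdIter, ih, add_assoc]

lemma weightedDual_le {f : E → ℝ} {g : E → E} (h : Cocoercive f g) (z : E) {L : List ℝ}
    (hL : ∀ a ∈ L, 0 ≤ a) (x : E) :
    weightedDual f g z x L ≤
      L.sum * (f z - 2⁻¹ * ‖g z‖ ^ 2) + ⟪x - gdIter g x L, g z⟫ := by
  induction L generalizing x with
  | nil => simp [weightedDual, gdIter]
  | cons a L ih =>
    have ih' := ih (fun b hb => hL b (List.mem_cons_of_mem _ hb)) (x - a • g x)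
    have h1 : f x - ⟪g x, x - z⟫ + 2⁻¹ * ‖g x‖ ^ 2 ≤ f z - 2⁻¹ * ‖g z‖ ^ 2 + ⟪g x, g z⟫ := by
      have := h x z
      rw [norm_sub_sq_real, real_inner_comm (g x) (g z), ← neg_sub x z, inner_neg_right] at this
      linarith
    have h2 := mul_le_mul_of_nonneg_left h1 (hL a List.mem_cons_self)
    simp only [weightedDual, gdIter, List.sum_cons]
    simp only [inner_sub_left, real_inner_smul_left] at ih' h2 ⊢
    linarith

/-- The potential inequality for a schedule `L`, with an arbitrary reference point. -/
def PotentialIneq (f : E → ℝ) (g : E → E) (L : List ℝ) : Prop :=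
  ∀ x z, L.sum * f (gdIter g x L) + L.sum * (L.sum + 1) / 2 * ‖g (gdIter g x L)‖ ^ 2
      + 2⁻¹ * ‖gdIter g x L - z‖ ^ 2
    ≤ 2⁻¹ * ‖x - z‖ ^ 2 + weightedDual f g z x L

/-- Comparison with the point `w` from which a step of length `b` was taken before running `L`. -/
lemma PotentialIneq.start {f : E → ℝ} {g : E → E} {L : List ℝ} (hP : PotentialIneq f g L)
    (h : Cocoercive f g) (hL : ∀ a ∈ L, 0 ≤ a) (w : E) (b : ℝ) {y e : E}
    (hy : gdIter g (w - b • g w) L = y) (he : y = w - b • g w - e) :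
    L.sum * (f y - f w) + L.sum * (L.sum + 1) / 2 * ⟪g y, g y⟫ + 2⁻¹ * ⟪e, e⟫
      + (b - 1) * ⟪e, g w⟫ + L.sum / 2 * ⟪g w, g w⟫ ≤ 0 := by
  have h1 := hP (w - b • g w) w
  have h2 := weightedDual_le h w hL (w - b • g w)
  have e1 : w - b • g w - y = e := by rw [he]; abel
  have e2 : y - w = -(b • g w + e) := by rw [he]; abel
  have e3 : w - b • g w - w = -(b • g w) := by abel
  rw [hy] at h1 h2
  rw [e1] at h2
  rw [e2, e3, norm_neg, norm_neg] at h1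
  simp only [← real_inner_self_eq_norm_sq, inner_add_left, inner_add_right, real_inner_smul_left,
    real_inner_smul_right, real_inner_comm e (g w)] at h1 h2 ⊢
  linarith

/-- Comparison with the last iterate. -/
lemma PotentialIneq.final {f : E → ℝ} {g : E → E} {L : List ℝ} (hP : PotentialIneq f g L)
    (h : Cocoercive f g) (hL : ∀ a ∈ L, 0 ≤ a) {x y e : E}
    (hy : gdIter g x L = y) (he : y = x - e) :
    L.sum * (L.sum + 2) / 2 * ⟪g y, g y⟫ ≤ 2⁻¹ * ⟪e, e⟫ + ⟪e, g y⟫ := by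
  have h1 := hP x y
  have h2 := weightedDual_le h y hL x
  have e1 : x - y = e := by rw [he]; abel
  rw [hy] at h1 h2
  rw [e1] at h1 h2
  simp only [← real_inner_self_eq_norm_sq, sub_self, inner_zero_left] at h1 h2 ⊢
  linarith

/-- Cocoercivity between the endpoints of a run, in both directions. -/
lemma Cocoercive.endpoints {f : E → ℝ} {g : E → E} (h : Cocoercive f g) (w : E) (b : ℝ) {y e : E}
    (he : y = w - b • g w - e) :
    (f y - f w) + ⟪e, g y⟫ + b * ⟪g w, g y⟫
        + 2⁻¹ * (⟪g y, g y⟫ - 2 * ⟪g w, g y⟫ + ⟪g w, g w⟫) ≤ 0 ∧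
      -(f y - f w) - ⟪e, g w⟫ - b * ⟪g w, g w⟫
        + 2⁻¹ * (⟪g y, g y⟫ - 2 * ⟪g w, g y⟫ + ⟪g w, g w⟫) ≤ 0 := by
  have h1 := h y w
  have h2 := h w y
  have e1 : y - w = -(b • g w + e) := by rw [he]; abel
  rw [← neg_sub y w, e1, neg_neg] at h1
  rw [e1] at h2
  simp only [← real_inner_self_eq_norm_sq, inner_add_right, inner_neg_right, inner_sub_left,
    inner_sub_right, real_inner_smul_right, real_inner_comm e, real_inner_comm (g w) (g y)]
    at h1 h2 ⊢
  constructor <;> linarith [real_inner_comm (g w) (g y), real_inner_comm e (g y),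
    real_inner_comm e (g w)]

/-- The value after a step of length `b` followed by `L`. -/
lemma PotentialIneq.value_le {f : E → ℝ} {g : E → E} {L : List ℝ} (hP : PotentialIneq f g L)
    (h : Cocoercive f g) (hL : ∀ a ∈ L, 0 ≤ a) (hs : L = [] ∨ 1 ≤ L.sum) (w : E) (b : ℝ) :
    f (gdIter g (w - b • g w) L) - f w ≤ 2⁻¹ * (b - 1) ^ 2 * ‖g w‖ ^ 2 := by
  obtain ⟨y, hy⟩ : ∃ y, gdIter g (w - b • g w) L = y := ⟨_, rfl⟩
  obtain ⟨e, he⟩ : ∃ e, y = w - b • g w - e := ⟨w - b • g w - y, by abel⟩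
  have hA := hP.start h hL w b hy he
  have hB := (h.endpoints w b he).1
  have hG : 0 ≤ ⟪g w, g w⟫ := real_inner_self_nonneg
  have hy0 : 0 ≤ ⟪g y, g y⟫ := real_inner_self_nonneg
  have hsq : 0 ≤ ⟪e + (b - 1) • g w, e + (b - 1) • g w⟫ := real_inner_self_nonneg
  simp only [inner_add_left, inner_add_right, real_inner_smul_left, real_inner_smul_right,
    real_inner_comm e (g w)] at hsq
  rw [hy, ← real_inner_self_eq_norm_sq]
  rcases hs with hs | hs
  · have hsq' : 0 ≤ ⟪g y + (b - 1) • g w, g y + (b - 1) • g w⟫ := real_inner_self_nonneg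
    simp only [inner_add_left, inner_add_right, real_inner_smul_left, real_inner_smul_right,
      real_inner_comm (g w) (g y)] at hsq'
    have he0 : e = 0 := by
      rw [hs, gdIter] at hy
      rw [← hy] at he
      exact sub_eq_self.1 he.symm
    rw [he0, inner_zero_left] at hB
    linarith [real_inner_comm (g w) (g y)]
  · have : L.sum * (f y - f w) ≤ 2⁻¹ * (b - 1) ^ 2 * ⟪g w, g w⟫ := by
      nlinarith [mul_nonneg (mul_nonneg (zero_le_one.trans hs) (by linarith : 0 ≤ L.sum + 1)) hy0,
        mul_nonneg (zero_le_one.trans hs) hG]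
    by_contra! hlt
    have : 0 ≤ 2⁻¹ * (b - 1) ^ 2 * ⟪g w, g w⟫ := by positivity
    nlinarith

lemma PotentialIneq.gradient_le {f : E → ℝ} {g : E → E} {L : List ℝ} (hP : PotentialIneq f g L)
    (h : Cocoercive f g) (hL : ∀ a ∈ L, 0 ≤ a) (w : E) (b : ℝ) :
    L.sum * (L.sum + 1) * ‖g (gdIter g (w - b • g w) L)‖ ^ 2
      ≤ ((b - 1) ^ 2 + L.sum * (L.sum + 1)) * ‖g w‖ ^ 2 := by
  obtain ⟨y, hy⟩ : ∃ y, gdIter g (w - b • g w) L = y := ⟨_, rfl⟩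
  obtain ⟨e, he⟩ : ∃ e, y = w - b • g w - e := ⟨w - b • g w - y, by abel⟩
  have hA := hP.start h hL w b hy he
  have hC := (h.endpoints w b he).2
  have hs : 0 ≤ L.sum := List.sum_nonneg hL
  have hsq : 0 ≤ ⟪e + (b - 1 - L.sum) • g w, e + (b - 1 - L.sum) • g w⟫ :=
    real_inner_self_nonneg
  have hd : 0 ≤ ⟪g y - g w, g y - g w⟫ := real_inner_self_nonneg
  simp only [inner_add_left, inner_add_right, inner_sub_left, inner_sub_right,
    real_inner_smul_left, real_inner_smul_right, real_inner_comm e (g w),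
    real_inner_comm (g w) (g y)] at hsq hd
  rw [hy, ← real_inner_self_eq_norm_sq, ← real_inner_self_eq_norm_sq]
  linear_combination 2 * hA + 2 * L.sum * hC + hsq + L.sum * hd

/-- Joining a schedule of sum `X - 1` with itself by the step `1 + (√2 - 1) X`. -/
lemma PotentialIneq.join {f : E → ℝ} {g : E → E} {L : List ℝ} (hP : PotentialIneq f g L)
    (h : Cocoercive f g) (hL : ∀ a ∈ L, 0 ≤ a) :
    PotentialIneq f g (L ++ (1 + (√2 - 1) * (L.sum + 1)) :: L) := by
  intro x z
  set b := 1 + (√2 - 1) * (L.sum + 1) with hb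
  rw [weightedDual_append, gdIter_append]
  set w := gdIter g x L with hw
  obtain ⟨y, hy⟩ : ∃ y, gdIter g (w - b • g w) L = y := ⟨_, rfl⟩
  obtain ⟨e, he⟩ : ∃ e, y = w - b • g w - e := ⟨w - b • g w - y, by abel⟩
  have hA := hP.start h hL w b hy he
  have hN := hP.final h hL hy he
  obtain ⟨hB, hC⟩ := h.endpoints w b he
  have h1 := hP x z
  have h2 := hP (w - b • g w) z
  rw [← hw] at h1
  simp only [gdIter, weightedDual, hy, List.sum_append, List.sum_cons] at h2 ⊢
  have e1 : ‖w - b • g w - z‖ ^ 2 = ‖w - z‖ ^ 2 - 2 * b * ⟪g w, w - z⟫ + b ^ 2 * ⟪g w, g w⟫ := by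
    have : w - b • g w - z = (w - z) - b • g w := by abel
    rw [this]
    simp only [← real_inner_self_eq_norm_sq, inner_sub_left (w - z), inner_sub_right _ (w - z),
      real_inner_smul_left, real_inner_smul_right, real_inner_comm (g w) (w - z)]
    ring
  rw [e1] at h2
  simp only [← real_inner_self_eq_norm_sq] at h1 h2 ⊢
  have hr : √2 ^ 2 = 2 := Real.sq_sqrt zero_le_two
  have h_one : 1 ≤ √2 := Real.one_le_sqrt.2 one_le_two
  have hs : 0 ≤ L.sum := List.sum_nonneg hL
  have key : (L.sum + b) * (f y - f w)
      + (L.sum + b) * (L.sum + b + 2 * L.sum + 1) / 2 * ⟪g y, g y⟫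
      ≤ (L.sum * (L.sum + 1) + b - b ^ 2) / 2 * ⟪g w, g w⟫ := by
    have hl : 0 ≤ √2 + 1 := by linarith
    have hn : 0 ≤ (√2 + 1) * (b - 1) := by
      have : 0 ≤ (√2 - 1) * (L.sum + 1) := mul_nonneg (by linarith) (by linarith)
      exact mul_nonneg hl (by linarith)
    have m1 := mul_le_mul_of_nonneg_left hA hl
    have m2 := mul_le_mul_of_nonneg_left hN hl
    have m3 := mul_le_mul_of_nonneg_left hB hl
    have m4 := mul_le_mul_of_nonneg_left hC hn
    have c1 : (√2 + 1) * (L.sum + 2 - b) = L.sum + b := by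
      rw [hb]; linear_combination -(L.sum + 1) * hr
    have c2 : (√2 + 1) * (2 * L.sum ^ 2 + 3 * L.sum + b)
        = (L.sum + b) * (L.sum + b + 2 * L.sum + 1) := by
      rw [hb]; linear_combination (L.sum + 1 - (L.sum + 1) ^ 2) * hr
    have c3 : (√2 + 1) * (L.sum - 2 * b ^ 2 + 3 * b)
        = -(L.sum * (L.sum + 1) + b - b ^ 2) := by
      rw [hb]; linear_combination ((L.sum + 1) ^ 2 * (1 - 2 * √2) - (L.sum + 1)) * hr
    linear_combination m1 + m2 + m3 + m4 - (f y - f w) * c1 - 2⁻¹ * ⟪g y, g y⟫ * c2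
      - 2⁻¹ * ⟪g w, g w⟫ * c3
  linarith

end Potential

section Silver

lemma phi_self {s : ℝ} (hs : -1 ≤ s) : phi s s = 1 + (√2 - 1) * (s + 1) := by
  have h : (s + s + 2) ^ 2 + 4 * (s + 1) * (s + 1) = (2 * √2 * (s + 1)) ^ 2 := by
    linear_combination -4 * (s + 1) ^ 2 * Real.sq_sqrt (zero_le_two (α := ℝ))
  have h0 : 0 ≤ 2 * √2 * (s + 1) := mul_nonneg (by positivity) (by linarith)
  rw [phi, h, Real.sqrt_sq h0]
  ring

lemma one_le_phi {x y : ℝ} (hx : 0 ≤ x) (hy : 0 ≤ y) : 1 ≤ phi x y := by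
  have : x + y + 2 ≤ √((x + y + 2) ^ 2 + 4 * (x + 1) * (y + 1)) :=
    Real.le_sqrt_of_sq_le (le_add_of_nonneg_right (by positivity))
  rw [phi]
  linarith

lemma add_one_le_five_mul_phi {x y : ℝ} (hx : 0 ≤ x) (hy : 0 ≤ y) (h : y + 1 ≤ 3 * (x + 1)) :
    y + 1 ≤ 5 * phi x y := by
  have : x + y + 2 + 2 / 5 * (y + 1) ≤ √((x + y + 2) ^ 2 + 4 * (x + 1) * (y + 1)) := by
    refine Real.le_sqrt_of_sq_le ?_
    nlinarith [mul_nonneg (by linarith : 0 ≤ y + 1) (by linarith : 0 ≤ 3 * (x + 1) - (y + 1))]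
  rw [phi]
  linarith

lemma sum_silver (j : ℕ) : (silver j).sum = (1 + √2) ^ j - 1 := by
  induction j with
  | zero => simp [silver]
  | succ j ih =>
    have h : (-1 : ℝ) ≤ (1 + √2) ^ j - 1 := by
      have : 0 ≤ (1 + √2) ^ j := by positivity
      linarith
    simp only [silver, concatSched, List.sum_append, List.sum_cons]
    rw [ih, phi_self h]
    ring

lemma sum_silver_nonneg (j : ℕ) : 0 ≤ (silver j).sum := by
  rw [sum_silver, sub_nonneg]
  exact one_le_pow₀ (le_add_of_nonneg_right (Real.sqrt_nonneg 2))

lemma silver_succ (j : ℕ) :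
    silver (j + 1) = silver j ++ (1 + (√2 - 1) * ((silver j).sum + 1)) :: silver j := by
  rw [silver, concatSched, phi_self (by linarith [sum_silver_nonneg j])]

lemma nonneg_of_mem_silver {j : ℕ} {a : ℝ} (ha : a ∈ silver j) : 0 ≤ a := by
  induction j with
  | zero => simp [silver] at ha
  | succ j ih =>
    rw [silver, concatSched, List.mem_append, List.mem_cons] at ha
    rcases ha with ha | rfl | ha
    · exact ih ha
    · exact zero_le_one.trans (one_le_phi (sum_silver_nonneg j) (sum_silver_nonneg j))
    · exact ih ha

variable {E : Type*} [NormedAddCommGroup E] [InnerProductSpace ℝ E]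

lemma potentialIneq_silver {f : E → ℝ} {g : E → E} (h : Cocoercive f g) (j : ℕ) :
    PotentialIneq f g (silver j) := by
  induction j with
  | zero => intro x z; simp [silver, gdIter, weightedDual]
  | succ j ih =>
    rw [silver_succ]
    exact ih.join h fun a => nonneg_of_mem_silver

/-- Along a proper prefix of a silver schedule run after a step of length `b` from `w`. -/
lemma silver_prefix_le {f : E → ℝ} {g : E → E} (h : Cocoercive f g) (j m : ℕ)
    (hm : m < (silver j).length) (w : E) (b : ℝ) :
    f (gdIter g (w - b • g w) ((silver j).take m)) - f w
      ≤ ((b - 1) ^ 2 + 1 / 10 * ((1 + √2) ^ j) ^ 2) * ‖g w‖ ^ 2 := by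
  induction j generalizing m w b with
  | zero => simp [silver] at hm
  | succ j ih =>
    have hr : √2 ^ 2 = 2 := Real.sq_sqrt zero_le_two
    have hr1 : 7 / 5 ≤ √2 := Real.le_sqrt_of_sq_le (by norm_num)
    have hr2 : √2 ≤ 2 := by nlinarith
    have hL : ∀ a ∈ silver j, 0 ≤ a := fun a => nonneg_of_mem_silver
    have hP := potentialIneq_silver h j
    set X := (1 + √2) ^ j with hX
    have hX0 : 0 ≤ X := by positivity
    have hG : 0 ≤ ‖g w‖ ^ 2 := by positivity
    have hXs : (silver j).sum = X - 1 := sum_silver j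
    have hmono : 1 / 2 * X ^ 2 ≤ 1 / 10 * ((1 + √2) ^ (j + 1)) ^ 2 := by
      rw [pow_succ _ j, ← hX]
      nlinarith [mul_nonneg (sq_nonneg X) (sub_nonneg.2 hr1)]
    have hj : j = 0 ∨ 1 + √2 ≤ X := by
      rcases Nat.eq_zero_or_pos j with hj | hj
      · exact .inl hj
      · exact .inr (le_self_pow₀ (by linarith) hj.ne')
    have hval := hP.value_le h hL (by
      rcases hj with hj | hj
      · left; rw [hj, silver]
      · right; linarith) w b
    rcases lt_trichotomy m (silver j).length with hlt | heq | hgt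
    · rw [silver_succ, List.take_append_of_le_length hlt.le]
      refine (ih m hlt w b).trans (mul_le_mul_of_nonneg_right ?_ hG)
      nlinarith [sq_nonneg X]
    · rw [silver_succ, heq, List.take_left]
      refine hval.trans (mul_le_mul_of_nonneg_right ?_ hG)
      nlinarith [sq_nonneg X, sq_nonneg (b - 1)]
    · obtain ⟨n, rfl⟩ := Nat.exists_eq_add_of_lt hgt
      have hn : n < (silver j).length := by
        simp only [silver_succ, List.length_append, List.length_cons] at hm
        omega
      have hj1 : 1 + √2 ≤ X := hj.resolve_left (by rintro rfl; simp [silver] at hn)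
      rw [silver_succ, add_assoc, List.take_length_add_append, List.take_succ_cons, gdIter_append,
        gdIter]
      set v := gdIter g (w - b • g w) (silver j) with hv
      have h1 := ih n hn v (1 + (√2 - 1) * ((silver j).sum + 1))
      have h2 := hP.gradient_le h hL w b
      rw [← hv, hXs] at h2
      rw [hXs] at h1 ⊢
      have h3 : (2 - √2) * X ^ 2 * ‖g v‖ ^ 2 ≤ ((b - 1) ^ 2 + X ^ 2) * ‖g w‖ ^ 2 := by
        refine le_trans (mul_le_mul_of_nonneg_right ?_ (by positivity)) (h2.trans
          (mul_le_mul_of_nonneg_right ?_ hG))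
        · nlinarith [mul_nonneg (mul_nonneg hX0 (sub_nonneg.2 hj1)) (by linarith : 0 ≤ √2 - 1)]
        · nlinarith
      have h4 : ((√2 - 1) ^ 2 + 1 / 10) * (X ^ 2 * ‖g v‖ ^ 2)
          ≤ 1 / 2 * (2 - √2) * (X ^ 2 * ‖g v‖ ^ 2) :=
        mul_le_mul_of_nonneg_right (by nlinarith) (by positivity)
      have h5 := mul_le_mul_of_nonneg_right hmono hG
      linarith

end Silver

section Schedule

lemma sum_le_sum_concatSched {s r : List ℝ} (hs : 0 ≤ s.sum) (hr : 0 ≤ r.sum) :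
    s.sum ≤ (concatSched s r).sum ∧ r.sum ≤ (concatSched s r).sum := by
  have := one_le_phi hs hr
  simp only [concatSched, List.sum_append, List.sum_cons]
  constructor <;> linarith

lemma shatSched_succ (c : ℝ) (i : ℕ) :
    shatSched c (i + 1) = concatSched (shatSched c i) (silver (blockIdx c (i + 1))) := rfl

lemma sum_shatSched_nonneg (c : ℝ) (i : ℕ) : 0 ≤ (shatSched c i).sum := by
  induction i with
  | zero => simp [shatSched, concatAll]
  | succ i ih =>
    exact ih.trans (sum_le_sum_concatSched ih (sum_silver_nonneg _)).1

lemma sum_shatSched_mono (c : ℝ) : Monotone fun i => (shatSched c i).sum :=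
  monotone_nat_of_le_succ fun i =>
    (sum_le_sum_concatSched (sum_shatSched_nonneg c i) (sum_silver_nonneg _)).1

lemma shatSched_prefix (c : ℝ) {i j : ℕ} (hij : i ≤ j) : shatSched c i <+: shatSched c j := by
  induction j, hij using Nat.le_induction with
  | base => exact List.prefix_rfl
  | succ j _ ih => exact ih.trans (List.prefix_append _ _)

lemma le_length_shatSched (c : ℝ) (i : ℕ) : i ≤ (shatSched c i).length := by
  induction i with
  | zero => exact Nat.zero_le _
  | succ i ih =>
    simp only [shatSched_succ, concatSched, List.length_append, List.length_cons]
    omega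

lemma shatEntry_succ (c : ℝ) {n k : ℕ} (hk : k < (shatSched c n).length) :
    shatEntry c (k + 1) = (shatSched c n).getD k 0 := by
  have hk' := le_length_shatSched c (k + 1)
  rw [shatEntry, Nat.add_sub_cancel]
  rcases le_total n (k + 1) with h | h
  · obtain ⟨r, hr⟩ := shatSched_prefix c h
    rw [← hr, List.getD_append _ _ _ _ hk]
  · obtain ⟨r, hr⟩ := shatSched_prefix c h
    rw [← hr, List.getD_append _ _ _ _ hk']

lemma strictMono_MSeq {c : ℝ} (hc : 0 ≤ c) : StrictMono (MSeq c) := by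
  refine strictMono_nat_of_lt_succ fun j => ?_
  rw [MSeq, MSeq, Finset.sum_Icc_succ_top (by omega), Nat.lt_add_right_iff_pos, kSeq,
    Nat.floor_pos]
  have : (1 : ℝ) ≤ 2 ^ (c * ((j + 1 : ℕ) : ℝ)) :=
    Real.one_le_rpow one_le_two (by positivity)
  linarith

lemma blockIdx_MSeq {c : ℝ} (hc : 0 ≤ c) (j : ℕ) : blockIdx c (MSeq c j) = j := by
  simp only [blockIdx, (strictMono_MSeq hc).le_iff_le]
  exact csInf_Ici

/-- The join stepsize dominates the silver schedule that follows it. -/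
lemma pow_blockIdx_le_join {c : ℝ} (hc : 0 ≤ c) (i : ℕ) :
    (1 + √2) ^ blockIdx c (i + 1)
      ≤ 5 * phi (shatSched c i).sum (silver (blockIdx c (i + 1))).sum := by
  have hr2 : √2 ≤ 2 := Real.sqrt_le_iff.2 (by norm_num)
  have hx := sum_shatSched_nonneg c i
  obtain ⟨j, hj⟩ : ∃ j, blockIdx c (i + 1) = j := ⟨_, rfl⟩
  rw [hj]
  have hy := sum_silver_nonneg j
  have hphi := one_le_phi hx hy
  match j, hj, hy, hphi with
  | 0, _, _, hphi => linarith [pow_zero (1 + √2)]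
  | 1, _, _, hphi => linarith [pow_one (1 + √2)]
  | k + 2, hj, hy, _ =>
    have hMi : MSeq c (k + 1) ≤ i := by
      have : k + 1 ∉ {j | i + 1 ≤ MSeq c j} :=
        Nat.notMem_of_lt_sInf (by rw [blockIdx] at hj; omega)
      simpa [Nat.lt_succ_iff] using this
    obtain ⟨n, hn⟩ : ∃ n, MSeq c (k + 1) = n + 1 :=
      Nat.exists_eq_succ_of_ne_zero
        ((Nat.zero_le _).trans_lt (strictMono_MSeq hc k.lt_succ_self)).ne'
    have h1 : (silver (k + 1)).sum ≤ (shatSched c (n + 1)).sum := by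
      have := (sum_le_sum_concatSched (sum_shatSched_nonneg c n)
        (sum_silver_nonneg (blockIdx c (n + 1)))).2
      rwa [← shatSched_succ, ← hn, blockIdx_MSeq hc, hn] at this
    have h2 := h1.trans (sum_shatSched_mono c (hn ▸ hMi))
    have h3 := add_one_le_five_mul_phi hx hy (by
      rw [sum_silver] at h2 ⊢
      have : 0 ≤ (1 + √2) ^ (k + 1) := by positivity
      rw [pow_succ _ (k + 1)]
      nlinarith)
    rw [sum_silver (k + 2)] at h3 ⊢
    linarith

lemma gdIter_take_eq {E : Type*} [AddCommGroup E] [SMul ℝ E] (g : E → E) (x : ℕ → E) (L : List ℝ)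
    (s : ℕ) (h : ∀ k < L.length, x (s + k + 1) = x (s + k) - L.getD k 0 • g (x (s + k)))
    {m : ℕ} (hm : m ≤ L.length) : gdIter g (x s) (L.take m) = x (s + m) := by
  induction L generalizing s m with
  | nil => simp_all [gdIter]
  | cons a L ih =>
    cases m with
    | zero => simp [gdIter]
    | succ m =>
      have h0 : x (s + 1) = x s - a • g (x s) := h 0 (Nat.succ_pos _)
      rw [List.take_succ_cons, gdIter, ← h0, ih (s + 1) (fun k hk => ?_) (Nat.le_of_succ_le_succ hm)]
      · congr 1; omega
      · have := h (k + 1) (Nat.succ_lt_succ hk)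
        rw [List.getD_cons_succ] at this
        rwa [add_assoc s 1 k, add_comm 1 k]

end Schedule

/-- intermediate-step control for gradient descent run with the
infinite schedule `ŝ`: between consecutive join steps, the suboptimality relative
to the preceding join step is bounded by `432·α_{t_i+1}²·‖g_{t_i+1}‖²`. -/
theorem shat_intermediate_step_bound (c : ℝ) (hc : 1 ≤ c)
    (d : ℕ) (f : EuclideanSpace ℝ (Fin d) → ℝ)
    (g : EuclideanSpace ℝ (Fin d) → EuclideanSpace ℝ (Fin d))
    (hconv : ConvexOn ℝ Set.univ f)
    (hgrad : ∀ y, HasGradientAt f (g y) y)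
    (hlip : LipschitzWith 1 g)
    (xstar : EuclideanSpace ℝ (Fin d)) (hmin : IsMinOn f Set.univ xstar)
    (x : ℕ → EuclideanSpace ℝ (Fin d))
    (hx : ∀ t : ℕ, 1 ≤ t → x (t + 1) = x t - shatEntry c t • g (x t)) :
    ∀ i : ℕ, 1 ≤ i → ∀ l : ℕ,
      (shatSched c i).length + 1 < l → l ≤ (shatSched c (i + 1)).length →
      f (x l) - f (x ((shatSched c i).length + 1)) ≤
        432 * shatEntry c ((shatSched c i).length + 1) ^ 2 *
          ‖g (x ((shatSched c i).length + 1))‖ ^ 2 := by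
  intro i _ l hl hl'
  have h := cocoercive_of_convexOn hconv hgrad hlip
  set j := blockIdx c (i + 1) with hj
  set t := (shatSched c i).length with ht
  set b := phi (shatSched c i).sum (silver j).sum with hb
  have hL : shatSched c (i + 1) = shatSched c i ++ b :: silver j := rfl
  have hlen : (shatSched c (i + 1)).length = t + 1 + (silver j).length := by
    rw [hL, List.length_append, List.length_cons]
    omega
  have hentry : shatEntry c (t + 1) = b := by
    rw [shatEntry_succ c (n := i + 1) (by omega), hL, List.getD_append_right _ _ _ _ le_rfl]
    simp
  have hsilver : ∀ k < (silver j).length, shatEntry c (t + 2 + k) = (silver j).getD k 0 := by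
    intro k hk
    rw [show t + 2 + k = (t + (k + 1)) + 1 by omega, shatEntry_succ c (n := i + 1) (by omega), hL,
      List.getD_append_right _ _ _ _ (Nat.le_add_right _ _), ← ht, Nat.add_sub_cancel_left,
      List.getD_cons_succ]
  obtain ⟨m, rfl⟩ : ∃ m, l = t + 2 + m := ⟨l - (t + 2), by omega⟩
  have hm : m < (silver j).length := by omega
  have hgd := gdIter_take_eq g x (silver j) (t + 2) (fun k hk => by
    rw [hx (t + 2 + k) (by omega), hsilver k hk]) hm.le
  rw [hx (t + 1) (by omega), hentry] at hgd
  have hmain := silver_prefix_le h j m hm (x (t + 1)) b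
  rw [hgd] at hmain
  rw [hentry]
  refine hmain.trans (mul_le_mul_of_nonneg_right ?_ (by positivity))
  have hjoin := pow_blockIdx_le_join (zero_le_one.trans hc) i
  rw [← hj, ← hb] at hjoin
  have hb1 : 1 ≤ b := one_le_phi (sum_shatSched_nonneg c i) (sum_silver_nonneg j)
  have hsq : ((1 + √2) ^ j) ^ 2 ≤ (5 * b) ^ 2 := pow_le_pow_left₀ (by positivity) hjoin 2
  nlinarith
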